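/- Let H be a real Hilbert space, C ⊆ H a nonempty convex subset, T : C → C an L-Lipschitzian pseudo-contraction (L > 0) that has at least one fixed point, and (αₙ), (βₙ) sequences in [0,1] such that lim βₙ = 0, ∑ₙ αₙβₙ = ∞, and αₙ ≤ βₙ for all n. Then for every x ∈ C, the Ishikawa iteration (xₙ) starting at x satisfies liminf_{n→∞} ‖xₙ − Txₙ‖ = 0. -/

import Mathlib

/-- The parallelogram-type identity for affine combinations of two vectors. -/
lemma norm_sq_smul_add_one_sub_smul {H : Type*} [NormedAddCommGroup H] [InnerProductSpace ℝ H]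
    (t : ℝ) (a b : H) :
    ‖t • a + (1 - t) • b‖ ^ 2
      = t * ‖a‖ ^ 2 + (1 - t) * ‖b‖ ^ 2 - t * (1 - t) * ‖a - b‖ ^ 2 := by
  rw [norm_add_sq_real, norm_sub_sq_real, norm_smul, norm_smul, mul_pow, mul_pow,
    inner_smul_left, inner_smul_right, Real.norm_eq_abs, Real.norm_eq_abs, sq_abs, sq_abs]
  simp only [conj_trivial]
  ring

/-- One Ishikawa step decreases the squared distance to a fixed point, up to an error term. -/
lemma ishikawa_step_norm_sq_le {H : Type*} [NormedAddCommGroup H] [InnerProductSpace ℝ H]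
    {T : H → H} {L a b : ℝ} {x y p : H} (ha : 0 ≤ a) (hb : 0 ≤ b) (hab : a ≤ b)
    (hy : y = b • T x + (1 - b) • x)
    (hLip : ‖T x - T y‖ ≤ L * ‖x - y‖)
    (hx_pc : ‖T x - p‖ ^ 2 ≤ ‖x - p‖ ^ 2 + ‖x - T x‖ ^ 2)
    (hy_pc : ‖T y - p‖ ^ 2 ≤ ‖y - p‖ ^ 2 + ‖y - T y‖ ^ 2) :
    ‖a • T y + (1 - a) • x - p‖ ^ 2
      ≤ ‖x - p‖ ^ 2 - a * b * (1 - 2 * b - L ^ 2 * b ^ 2) * ‖x - T x‖ ^ 2 := by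
  have e₁ : ‖a • T y + (1 - a) • x - p‖ ^ 2
      = a * ‖T y - p‖ ^ 2 + (1 - a) * ‖x - p‖ ^ 2 - a * (1 - a) * ‖x - T y‖ ^ 2 := by
    have h := norm_sq_smul_add_one_sub_smul a (T y - p) (x - p)
    rw [sub_sub_sub_cancel_right, norm_sub_rev (T y) x] at h
    rw [← h]
    congr 2
    module
  have e₂ : ‖y - p‖ ^ 2
      = b * ‖T x - p‖ ^ 2 + (1 - b) * ‖x - p‖ ^ 2 - b * (1 - b) * ‖x - T x‖ ^ 2 := by
    have h := norm_sq_smul_add_one_sub_smul b (T x - p) (x - p)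
    rw [sub_sub_sub_cancel_right, norm_sub_rev (T x) x] at h
    rw [← h, hy]
    congr 2
    module
  have e₃ : ‖y - T y‖ ^ 2
      = b * ‖T x - T y‖ ^ 2 + (1 - b) * ‖x - T y‖ ^ 2 - b * (1 - b) * ‖x - T x‖ ^ 2 := by
    have h := norm_sq_smul_add_one_sub_smul b (T x - T y) (x - T y)
    rw [sub_sub_sub_cancel_right, norm_sub_rev (T x) x] at h
    rw [← h]
    congr 2
    nth_rewrite 1 [hy]
    module
  have e₄ : ‖x - y‖ = b * ‖x - T x‖ := by
    have h : x - y = b • (x - T x) := by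
      rw [hy]
      module
    rw [h, norm_smul, Real.norm_of_nonneg hb]
  have h₄ : ‖T x - T y‖ ^ 2 ≤ L ^ 2 * b ^ 2 * ‖x - T x‖ ^ 2 := by
    calc ‖T x - T y‖ ^ 2 ≤ (L * ‖x - y‖) ^ 2 := by gcongr
      _ = L ^ 2 * b ^ 2 * ‖x - T x‖ ^ 2 := by rw [e₄]; ring
  have h₅ := mul_le_mul_of_nonneg_left h₄ hb
  have h₆ := mul_le_mul_of_nonneg_left hx_pc hb
  have h₇ : ‖T y - p‖ ^ 2 ≤ ‖x - p‖ ^ 2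
      - b * (1 - 2 * b - L ^ 2 * b ^ 2) * ‖x - T x‖ ^ 2 + (1 - b) * ‖x - T y‖ ^ 2 := by
    linarith
  have h₈ := mul_le_mul_of_nonneg_left h₇ ha
  have h₉ : 0 ≤ a * (b - a) * ‖x - T y‖ ^ 2 :=
    mul_nonneg (mul_nonneg ha (sub_nonneg.2 hab)) (sq_nonneg _)
  rw [e₁]
  linarith

/-- A nonnegative sequence cannot eventually decrease by at least a fixed positive multiple of
the terms of a series diverging to `+∞`. -/
lemma not_eventually_add_le_of_tendsto_sum_atTop {u w : ℕ → ℝ} {c : ℝ} (hc : 0 < c)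
    (hu : ∀ n, 0 ≤ u n)
    (hw : Filter.Tendsto (fun n => ∑ i ∈ Finset.range n, w i) Filter.atTop Filter.atTop) :
    ¬ ∀ᶠ n in Filter.atTop, u (n + 1) + c * w n ≤ u n := by
  intro h
  obtain ⟨N, hN⟩ := Filter.eventually_atTop.1 h
  have hbound : ∀ n ≥ N, u n + c * ∑ i ∈ Finset.range n, w i
      ≤ u N + c * ∑ i ∈ Finset.range N, w i := by
    intro n hn
    induction n, hn using Nat.le_induction with
    | base => exact le_rfl
    | succ n hn ih =>
      rw [Finset.sum_range_succ]
      linarith [hN n hn]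
  obtain ⟨n, hn, hlt⟩ := ((Filter.eventually_ge_atTop N).and
    ((hw.const_mul_atTop hc).eventually_gt_atTop
      (u N + c * ∑ i ∈ Finset.range N, w i))).exists
  linarith [hbound n hn, hu n]

/-- under (A1)-(A3), if the `L`-Lipschitzian pseudo-contraction `T` has a
fixed point, then `liminf ‖xₙ − Txₙ‖ = 0` for the Ishikawa iteration. -/
theorem ishikawa_liminf_zero
    {H : Type*} [NormedAddCommGroup H] [InnerProductSpace ℝ H]
    (C : Set H) (hCne : C.Nonempty) (hCconv : Convex ℝ C)
    (T : H → H) (hTmap : ∀ c ∈ C, T c ∈ C)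
    (L : ℝ) (hL : 0 < L)
    (hLip : ∀ c ∈ C, ∀ d ∈ C, ‖T c - T d‖ ≤ L * ‖c - d‖)
    (hPC : ∀ c ∈ C, ∀ d ∈ C,
      ‖T c - T d‖ ^ 2 ≤ ‖c - d‖ ^ 2 + ‖(c - T c) - (d - T d)‖ ^ 2)
    (hFix : ∃ p ∈ C, T p = p)
    (α β : ℕ → ℝ)
    (hα : ∀ n, α n ∈ Set.Icc (0 : ℝ) 1) (hβmem : ∀ n, β n ∈ Set.Icc (0 : ℝ) 1)
    (hA1 : Filter.Tendsto β Filter.atTop (nhds 0))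
    (hA2 : Filter.Tendsto (fun n => ∑ i ∈ Finset.range n, α i * β i)
      Filter.atTop Filter.atTop)
    (hA3 : ∀ n, α n ≤ β n)
    (x₀ : H) (hx₀ : x₀ ∈ C)
    (x y : ℕ → H) (hx0 : x 0 = x₀)
    (hy : ∀ n, y n = β n • T (x n) + (1 - β n) • x n)
    (hxs : ∀ n, x (n + 1) = α n • T (y n) + (1 - α n) • x n) :
    Filter.liminf (fun n => ‖x n - T (x n)‖) Filter.atTop = 0 := by
  obtain ⟨p, hpC, hp⟩ := hFix
  have hyC : ∀ n, x n ∈ C → y n ∈ C := fun n hn => by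
    rw [hy]
    exact hCconv (hTmap _ hn) hn (hβmem n).1 (sub_nonneg.2 (hβmem n).2) (by ring)
  have hxC : ∀ n, x n ∈ C := by
    intro n
    induction n with
    | zero => rwa [hx0]
    | succ n ih =>
      rw [hxs]
      exact hCconv (hTmap _ (hyC n ih)) ih (hα n).1 (sub_nonneg.2 (hα n).2) (by ring)
  have hpc : ∀ c ∈ C, ‖T c - p‖ ^ 2 ≤ ‖c - p‖ ^ 2 + ‖c - T c‖ ^ 2 := fun c hc => by
    simpa [hp] using hPC c hc p hpC
  have hstep : ∀ n, ‖x (n + 1) - p‖ ^ 2 ≤ ‖x n - p‖ ^ 2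
      - α n * β n * (1 - 2 * β n - L ^ 2 * β n ^ 2) * ‖x n - T (x n)‖ ^ 2 := fun n => by
    have hyn := hyC n (hxC n)
    rw [hxs]
    exact ishikawa_step_norm_sq_le (hα n).1 (hβmem n).1 (hA3 n) (hy n)
      (hLip _ (hxC n) _ hyn) (hpc _ (hxC n)) (hpc _ hyn)
  have hcoef : ∀ᶠ n in Filter.atTop, 1 / 2 < 1 - 2 * β n - L ^ 2 * β n ^ 2 := by
    have h : Filter.Tendsto (fun n => 1 - 2 * β n - L ^ 2 * β n ^ 2) Filter.atTop
        (nhds (1 - 2 * 0 - L ^ 2 * 0 ^ 2)) :=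
      (tendsto_const_nhds.sub (hA1.const_mul 2)).sub ((hA1.pow 2).const_mul (L ^ 2))
    exact h.eventually_const_lt (by norm_num)
  have hfreq : ∀ ε > 0, ∃ᶠ n in Filter.atTop, ‖x n - T (x n)‖ ≤ ε := by
    intro ε hε hev
    refine not_eventually_add_le_of_tendsto_sum_atTop (u := fun n => ‖x n - p‖ ^ 2)
      (c := 1 / 2 * ε ^ 2) (by positivity) (fun n => sq_nonneg _) hA2 ?_
    filter_upwards [hev, hcoef] with n hn hk
    have hαβ : 0 ≤ α n * β n := mul_nonneg (hα n).1 (hβmem n).1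
    have hmul : 1 / 2 * ε ^ 2 ≤ (1 - 2 * β n - L ^ 2 * β n ^ 2) * ‖x n - T (x n)‖ ^ 2 := by
      have := (not_le.1 hn).le
      gcongr
    linarith [hstep n, mul_le_mul_of_nonneg_left hmul hαβ]
  have hbdd : Filter.IsBoundedUnder (· ≥ ·) Filter.atTop (fun n => ‖x n - T (x n)‖) :=
    Filter.isBoundedUnder_of ⟨0, fun n => norm_nonneg _⟩
  apply le_antisymm
  · exact le_of_forall_pos_le_add fun ε hε => by
      rw [zero_add]
      exact Filter.liminf_le_of_frequently_le (hfreq ε hε) hbdd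
  · exact Filter.le_liminf_of_le
      (Filter.IsCoboundedUnder.of_frequently_le (hfreq 1 one_pos))
      (Filter.Eventually.of_forall fun n => norm_nonneg _)
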